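/- Let g, Δ ∈ 𝔽_q[T] with Δ ≠ 0, and let φ be the rank 2 Drinfeld module with φ_T(x) = T·x + g·x^q + Δ·x^{q²}. Assume that Δ splits completely over 𝔽_q (every monic irreducible factor of Δ has degree 1) and that φ_T(1) = T + g + Δ is coprime to TΔ in 𝔽_q[T]. If x ∈ 𝔽_q[T] is coprime to TΔ and is not a torsion point of φ, then every n in the Zsigmondy set Z(φ,x) satisfies n ≤ (6(q² − 1)·|S| + 4) + (1/2)·log_q(2 + 2·deg g + 2·deg Δ). -/

import Mathlib

open Polynomial UniqueFactorizationMonoid Filter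

/-- The number of distinct monic irreducible factors of `f`. -/
noncomputable def numMonicIrredFactors {Fq : Type*} [Field Fq] [DecidableEq Fq]
    (f : Polynomial Fq) : ℕ :=
  letI := Classical.decEq (Polynomial Fq)
  (normalizedFactors f).toFinset.card

/-- Explicit Zsigmondy bound for the rank 2 Drinfeld module
`φ_T(x) = T·x + g·x^q + Δ·x^{q²}` when `Δ` splits completely over `𝔽_q`:
if `φ_T(1) = T + g + Δ` is coprime to `TΔ` and `x ∈ 𝔽_q[T]` is coprime to `TΔ` and not a
torsion point of `φ`, then every `n ≥ 1` such that `𝔄_n = φ_{T^n}(x)` has no primitive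
divisor satisfies `n ≤ (6(q² − 1)·|S| + 4) + (1/2)·log_q(2 + 2 deg g + 2 deg Δ)`. -/
theorem zsigmondy_bound_rank_two_split
    {Fq : Type*} [Field Fq] [Fintype Fq] [DecidableEq Fq]
    (q : ℕ) (hq : q = Fintype.card Fq)
    (g Δ : Polynomial Fq) (hΔ : Δ ≠ 0)
    (φ : Polynomial Fq → Polynomial Fq)
    (hφ : ∀ y, φ y = Polynomial.X * y + g * y ^ q + Δ * y ^ q ^ 2)
    (hsplit : ∀ P : Polynomial Fq, P.Monic → Irreducible P → P ∣ Δ → P.natDegree = 1)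
    (S : ℕ) (hS : S = 1 + numMonicIrredFactors (Polynomial.X * Δ))
    (hcop : IsCoprime (Polynomial.X + g + Δ) (Polynomial.X * Δ))
    (x : Polynomial Fq) (hx : IsCoprime x (Polynomial.X * Δ))
    (htor : ¬ (Set.range fun n => φ^[n] x).Finite)
    (n : ℕ) (hn : 1 ≤ n)
    (hnoprim : ¬ ∃ P : Polynomial Fq, Irreducible P ∧ P ∣ φ^[n] x ∧ ∀ i < n, ¬ P ∣ φ^[i] x) :
    (n : ℝ) ≤ (6 * ((q : ℝ) ^ 2 - 1) * (S : ℝ) + 4)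
      + (1 / 2) * Real.logb q (2 + 2 * (g.natDegree : ℝ) + 2 * (Δ.natDegree : ℝ)) := by
  exfalso
  have hq2 : 2 ≤ q := by rw [hq]; exact Fintype.one_lt_card
  have hpow : ∀ a : Fq, a ^ q = a := fun a => by rw [hq]; exact FiniteField.pow_card a
  have hpow2 : ∀ a : Fq, a ^ q ^ 2 = a := fun a => by rw [pow_two, pow_mul, hpow, hpow]
  -- factorization
  have hfac : ∀ y, φ y = y * (Polynomial.X + g * y ^ (q - 1) + Δ * y ^ (q ^ 2 - 1)) := by
    intro y
    have h1 : y ^ q = y * y ^ (q - 1) := by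
      rw [← pow_succ']; congr 1; omega
    have h2 : y ^ q ^ 2 = y * y ^ (q ^ 2 - 1) := by
      rw [← pow_succ']; congr 1
      have : 0 < q ^ 2 := by positivity
      omega
    rw [hφ, h1, h2]; ring
  have hlin : ∀ (c : Fq) y, φ (C c * y) = C c * φ y := by
    intro c y
    rw [hφ, hφ, mul_pow, mul_pow, ← C_pow, ← C_pow, hpow, hpow2]; ring
  -- nonvanishing at zero
  have hcop0 : (Polynomial.X + g + Δ).eval 0 ≠ 0 := by
    obtain ⟨a, b, h⟩ := hcop
    intro h0
    have := congrArg (Polynomial.eval 0) h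
    simp only [eval_add, eval_mul, eval_X, eval_one] at this h0
    rw [h0] at this
    simp at this
  have hx0 : x.eval 0 ≠ 0 := by
    obtain ⟨a, b, h⟩ := hx
    intro h0
    have := congrArg (Polynomial.eval 0) h
    simp only [eval_add, eval_mul, eval_X, eval_one] at this
    rw [h0] at this
    simp at this
  have hA0 : ∀ k, (φ^[k] x).eval 0 ≠ 0 := by
    intro k
    induction k with
    | zero => simpa using hx0
    | succ k ih =>
      rw [Function.iterate_succ_apply', hφ]
      have : (Polynomial.X * (φ^[k] x) + g * (φ^[k] x) ^ q + Δ * (φ^[k] x) ^ q ^ 2).eval 0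
          = (Polynomial.X + g + Δ).eval 0 * (φ^[k] x).eval 0 := by
        simp only [eval_add, eval_mul, eval_pow, eval_X, hpow, hpow2]; ring
      rw [this]
      exact mul_ne_zero hcop0 ih
  have hdvd : ∀ i j, i ≤ j → φ^[i] x ∣ φ^[j] x := by
    intro i j hij
    induction j, hij using Nat.le_induction with
    | base => exact dvd_rfl
    | succ j _ ih =>
      rw [Function.iterate_succ_apply', hfac]
      exact ih.mul_right _
  obtain ⟨m, rfl⟩ : ∃ m, n = m + 1 := ⟨n - 1, by omega⟩
  have hBA := hfac (φ^[m] x)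
  have hA := hA0 (m + 1)
  rw [Function.iterate_succ_apply'] at hnoprim hA
  set y := φ^[m] x with hy
  set B := Polynomial.X + g * y ^ (q - 1) + Δ * y ^ (q ^ 2 - 1) with hB
  have hBne : B ≠ 0 := by
    intro h
    rw [hBA, h] at hA
    simp at hA
  by_cases hu : IsUnit B
  · obtain ⟨c, _, hc⟩ := Polynomial.isUnit_iff.mp hu
    have hit : ∀ k, φ^[k] y = C (c ^ k) * y := by
      intro k
      induction k with
      | zero => simp
      | succ k ih =>
        rw [Function.iterate_succ_apply', ih, hlin, hBA, ← hc, pow_succ, C_mul]; ring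
    apply htor
    refine (((Set.finite_lt_nat m).image fun k => φ^[k] x).union
      (Set.finite_range fun a : Fq => C a * y)).subset ?_
    rintro _ ⟨k, rfl⟩
    by_cases hk : k < m
    · exact Or.inl ⟨k, hk, rfl⟩
    · refine Or.inr ⟨c ^ (k - m), ?_⟩
      simp only
      rw [← hit, hy, ← Function.iterate_add_apply]
      congr 2
      omega
  · obtain ⟨P, hP, hPB⟩ := WfDvdMonoid.exists_irreducible_factor hu hBne
    refine hnoprim ⟨P, hP, hBA ▸ hPB.mul_left _, fun i hi hPi => ?_⟩
    have hPy : P ∣ y := hPi.trans (hdvd i m (by omega))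
    have hPX : P ∣ Polynomial.X := by
      have h1 : P ∣ g * y ^ (q - 1) := (dvd_pow hPy (by omega)).mul_left _
      have h2 : P ∣ Δ * y ^ (q ^ 2 - 1) := by
        refine (dvd_pow hPy ?_).mul_left _
        have : 2 ^ 2 ≤ q ^ 2 := Nat.pow_le_pow_left hq2 2
        omega
      rw [hB] at hPB
      exact (dvd_add_left h1).mp ((dvd_add_left h2).mp hPB)
    have hXP : Polynomial.X ∣ P := (hP.associated_of_dvd Polynomial.irreducible_X hPX).symm.dvd
    have := hXP.trans hPy
    rw [Polynomial.X_dvd_iff, Polynomial.coeff_zero_eq_eval_zero] at this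
    exact hA0 m this
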